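/- arXiv:1109.6269 — 5 statements merged into one kernel-verified Lean document; each statement's English description precedes it below -/
import Mathlib

section
/- For any complex matrices H ∈ ℂ^{N×M} and W ∈ ℂ^{M×d}, and any receive filter G ∈ ℂ^{N×d}, one has log((det(E(G,W)⁻¹)).re) ≤ log((det(I_N + H W W† H†)).re), and equality holds when G equals the LMMSE filter Ĝ := (H W W† H† + I_N)⁻¹ H W. Hence the achievable rate R(W) := log((det(I_N + H W W† H†)).re) equals the maximum over all G of log((det(E(G,W)⁻¹)).re). -/
open Matrix
open scoped ComplexOrder

/-- The MSE matrix E(G,W) := (G† H W − I_d)(G† H W − I_d)† + G† G. -/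
noncomputable def mseMatrix {N M d : ℕ} (H : Matrix (Fin N) (Fin M) ℂ)
    (W : Matrix (Fin M) (Fin d) ℂ) (G : Matrix (Fin N) (Fin d) ℂ) :
    Matrix (Fin d) (Fin d) ℂ :=
  (Gᴴ * H * W - 1) * (Gᴴ * H * W - 1)ᴴ + Gᴴ * G

/-- The LMMSE filter Ĝ := (H W W† H† + I_N)⁻¹ H W. -/
noncomputable def lmmseFilter {N M d : ℕ} (H : Matrix (Fin N) (Fin M) ℂ)
    (W : Matrix (Fin M) (Fin d) ℂ) : Matrix (Fin N) (Fin d) ℂ :=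
  (H * W * Wᴴ * Hᴴ + 1)⁻¹ * (H * W)

theorem aux_one_le_det {n : ℕ} (R : Matrix (Fin n) (Fin n) ℂ) (hR : R.PosSemidef) :
    1 ≤ (1 + R).det := by
  have h1 : (1 + R).IsHermitian := isHermitian_one.add hR.1
  rw [h1.det_eq_prod_eigenvalues]
  have h2 : ∀ i, 1 ≤ h1.eigenvalues i := by
    intro i
    have hv : star (h1.eigenvectorBasis i).ofLp ⬝ᵥ (h1.eigenvectorBasis i).ofLp = 1 := by
      have := h1.eigenvectorBasis.orthonormal.1 i
      have h3 := inner_self_eq_norm_sq_to_K (𝕜 := ℂ) (h1.eigenvectorBasis i)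
      rw [this, EuclideanSpace.inner_eq_star_dotProduct, dotProduct_comm] at h3
      simpa using h3
    rw [h1.eigenvalues_eq, Matrix.add_mulVec, Matrix.one_mulVec, dotProduct_add, hv]
    have := hR.re_dotProduct_nonneg (h1.eigenvectorBasis i).ofLp
    simpa using this
  have h3 : (1 : ℝ) ≤ ∏ i, h1.eigenvalues i := by
    have := Finset.prod_le_prod (s := Finset.univ) (f := fun _ : Fin n => (1 : ℝ))
      (g := h1.eigenvalues) (fun i _ => zero_le_one) (fun i _ => h2 i)
    simpa using this
  have h4 : ((1 : ℝ) : ℂ) ≤ ((∏ i, h1.eigenvalues i : ℝ) : ℂ) := Complex.real_le_real.2 h3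
  simpa using h4

theorem aux_det_mul {n : ℕ} (C P : Matrix (Fin n) (Fin n) ℂ) (hC : C.PosDef)
    (hP : P.PosSemidef) : 1 ≤ C.det * (C⁻¹ + P).det := by
  obtain ⟨Q, rfl⟩ : ∃ Q, P = Qᴴ * Q := by
    open scoped MatrixOrder in
    exact CStarAlgebra.nonneg_iff_eq_star_mul_self.mp (Matrix.nonneg_iff_posSemidef.mpr hP)
  rw [← det_mul, mul_add, mul_nonsing_inv _ ((isUnit_iff_isUnit_det _).1 hC.isUnit),
    ← mul_assoc, det_one_add_mul_comm, ← mul_assoc]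
  exact aux_one_le_det _ (hC.posSemidef.mul_mul_conjTranspose_same Q)

theorem aux_identity {N d : ℕ} (A G : Matrix (Fin N) (Fin d) ℂ) (C : Matrix (Fin d) (Fin d) ℂ)
    (hCd : C = 1 + Aᴴ * A) (hC : C.PosDef) :
    (Gᴴ * A - 1) * (Gᴴ * A - 1)ᴴ + Gᴴ * G
      = C⁻¹ + (G - A * C⁻¹)ᴴ * (A * Aᴴ + 1) * (G - A * C⁻¹) := by
  have hu := (isUnit_iff_isUnit_det _).1 hC.isUnit
  have hCi : (C⁻¹)ᴴ = C⁻¹ := hC.inv.1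
  have h1 : (A * Aᴴ + 1) * (A * C⁻¹) = A := by
    have : (A * Aᴴ + 1) * A = A * C := by
      rw [hCd]; simp only [Matrix.mul_assoc, Matrix.one_mul, Matrix.mul_one,
        Matrix.add_mul, Matrix.mul_add]; abel
    rw [← Matrix.mul_assoc, this, Matrix.mul_assoc, mul_nonsing_inv _ hu, Matrix.mul_one]
  have h2 : C⁻¹ * Aᴴ * (A * Aᴴ + 1) = Aᴴ := by
    have := congrArg conjTranspose h1
    simpa [conjTranspose_mul, hCi, Matrix.mul_assoc] using this
  have h3 : C⁻¹ + C⁻¹ * (Aᴴ * A) = 1 := by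
    have : C⁻¹ * C = 1 := nonsing_inv_mul _ hu
    rw [← this]; nth_rw 4 [hCd]; rw [mul_add, mul_one]
  have e : (G - A * C⁻¹)ᴴ * (A * Aᴴ + 1) = Gᴴ * (A * Aᴴ + 1) - Aᴴ := by
    rw [conjTranspose_sub, conjTranspose_mul, hCi, Matrix.sub_mul, h2]
  have h4 : Aᴴ * (A * C⁻¹) = 1 - C⁻¹ := by
    have := congrArg conjTranspose h3
    simp only [conjTranspose_add, conjTranspose_mul, hCi, conjTranspose_conjTranspose,
      conjTranspose_one] at this
    rw [← this, Matrix.mul_assoc]; abel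
  rw [e, Matrix.mul_sub _ G, Matrix.sub_mul _ _ (A * C⁻¹), Matrix.mul_assoc Gᴴ _ (A * C⁻¹), h1, h4]
  simp only [conjTranspose_sub, conjTranspose_mul, conjTranspose_conjTranspose, conjTranspose_one,
    Matrix.sub_mul, Matrix.mul_sub, Matrix.add_mul, Matrix.mul_add, Matrix.mul_assoc,
    Matrix.one_mul, Matrix.mul_one]
  abel

/-- For any H ∈ ℂ^{N×M}, W ∈ ℂ^{M×d} and any receive filter G ∈ ℂ^{N×d},
log((det(E(G,W)⁻¹)).re) ≤ log((det(I_N + H W W† H†)).re), with equality when G is the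
LMMSE filter Ĝ := (H W W† H† + I_N)⁻¹ H W. Hence the achievable rate
R(W) := log((det(I_N + H W W† H†)).re) equals the maximum over all G of
log((det(E(G,W)⁻¹)).re). -/
theorem rate_eq_max_logdet_inv_mse {N M d : ℕ} (H : Matrix (Fin N) (Fin M) ℂ)
    (W : Matrix (Fin M) (Fin d) ℂ) :
    (∀ G : Matrix (Fin N) (Fin d) ℂ,
      Real.log (((mseMatrix H W G)⁻¹).det.re)
        ≤ Real.log ((1 + H * W * Wᴴ * Hᴴ).det.re)) ∧
    Real.log (((mseMatrix H W (lmmseFilter H W))⁻¹).det.re)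
        = Real.log ((1 + H * W * Wᴴ * Hᴴ).det.re) ∧
    IsGreatest {v : ℝ | ∃ G : Matrix (Fin N) (Fin d) ℂ,
        v = Real.log (((mseMatrix H W G)⁻¹).det.re)}
      (Real.log ((1 + H * W * Wᴴ * Hᴴ).det.re)) := by
  set A := H * W with hA
  have hK : A * Wᴴ * Hᴴ = A * Aᴴ := by rw [hA, conjTranspose_mul, Matrix.mul_assoc (H * W)]
  set C : Matrix (Fin d) (Fin d) ℂ := 1 + Aᴴ * A with hCd
  have hC : C.PosDef := PosDef.one.add_posSemidef (posSemidef_conjTranspose_mul_self A)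
  have hKp : (A * Aᴴ + 1).PosDef :=
    PosDef.one.posSemidef_add (posSemidef_self_mul_conjTranspose A)
  have hu := (isUnit_iff_isUnit_det _).1 hC.isUnit
  have hKu := (isUnit_iff_isUnit_det _).1 hKp.isUnit
  have hdet : (1 + A * Wᴴ * Hᴴ).det = C.det := by rw [hK, det_one_add_mul_comm]
  have hE : ∀ G, mseMatrix H W G
      = C⁻¹ + (G - A * C⁻¹)ᴴ * (A * Aᴴ + 1) * (G - A * C⁻¹) := by
    intro G
    rw [← aux_identity A G C hCd hC, mseMatrix, Matrix.mul_assoc Gᴴ H W]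
  have hL : lmmseFilter H W = A * C⁻¹ := by
    have h1 : (A * Aᴴ + 1) * A = A * C := by
      rw [hCd]; simp only [Matrix.mul_assoc, Matrix.one_mul, Matrix.mul_one,
        Matrix.add_mul, Matrix.mul_add]; abel
    have h2 : (A * Aᴴ + 1) * (A * C⁻¹) = A := by
      rw [← Matrix.mul_assoc, h1, Matrix.mul_assoc, mul_nonsing_inv _ hu, Matrix.mul_one]
    rw [lmmseFilter, ← hA, hK]
    have h5 : (A * Aᴴ + 1)⁻¹ * A = (A * Aᴴ + 1)⁻¹ * ((A * Aᴴ + 1) * (A * C⁻¹)) := by rw [h2]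
    rw [h5, ← Matrix.mul_assoc, nonsing_inv_mul _ hKu, Matrix.one_mul]
  rw [hdet]
  have hEq : Real.log (((mseMatrix H W (lmmseFilter H W))⁻¹).det.re) = Real.log C.det.re := by
    rw [hE, hL]
    simp [nonsing_inv_nonsing_inv _ hu]
  have hLe : ∀ G : Matrix (Fin N) (Fin d) ℂ,
      Real.log (((mseMatrix H W G)⁻¹).det.re) ≤ Real.log C.det.re := by
    intro G
    have hP := hKp.posSemidef.conjTranspose_mul_mul_same (G - A * C⁻¹)
    have h1 := aux_det_mul C _ hC hP
    have hEp : (mseMatrix H W G).PosDef := by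
      rw [hE]; exact hC.inv.add_posSemidef hP
    rw [← hE] at h1
    have hi := hEp.inv.det_pos
    have h2 : ((mseMatrix H W G)⁻¹).det ≤ C.det := by
      have h3 := mul_le_mul_of_nonneg_right h1 hi.le
      rwa [one_mul, mul_assoc, ← det_mul,
        mul_nonsing_inv _ ((isUnit_iff_isUnit_det _).1 hEp.isUnit), det_one, mul_one] at h3
    exact Real.log_le_log (Complex.pos_iff.1 hi).1 (Complex.le_def.1 h2).1
  refine ⟨hLe, hEq, ⟨_, hEq.symm⟩, ?_⟩
  rintro v ⟨G, rfl⟩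
  exact hLe G
end

section
/- For any complex matrices H ∈ ℂ^{N×M}, W ∈ ℂ^{M×d}, any Hermitian positive semidefinite S ∈ ℂ^{d×d}, and any receive filter G ∈ ℂ^{N×d}, the weighted MSE at the LMMSE filter is minimal: Re(Tr(S · E(Ĝ,W))) ≤ Re(Tr(S · E(G,W))), where Ĝ := (H W W† H† + I_N)⁻¹ H W. -/
open Matrix
open scoped ComplexOrder

/-- For any H ∈ ℂ^{N×M}, W ∈ ℂ^{M×d}, any Hermitian positive semidefinite S ∈ ℂ^{d×d}, and any
receive filter G ∈ ℂ^{N×d}, the weighted MSE at the LMMSE filter is minimal: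
Re(Tr(S · E(Ĝ,W))) ≤ Re(Tr(S · E(G,W))). -/
theorem weighted_mse_min_at_lmmse {N M d : ℕ} (H : Matrix (Fin N) (Fin M) ℂ)
    (W : Matrix (Fin M) (Fin d) ℂ) (S : Matrix (Fin d) (Fin d) ℂ) (hS : S.PosSemidef)
    (G : Matrix (Fin N) (Fin d) ℂ) :
    (S * mseMatrix H W (lmmseFilter H W)).trace.re ≤ (S * mseMatrix H W G).trace.re := by
  set F := lmmseFilter H W with hF
  obtain ⟨D, rfl⟩ : ∃ D, G = F + D := ⟨G - F, by abel⟩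
  have hpd : (H * W * Wᴴ * Hᴴ + 1).PosDef := by
    have h := (Matrix.posSemidef_self_mul_conjTranspose (H * W))
    have h2 := Matrix.PosDef.posSemidef_add h (Matrix.PosDef.one (n := Fin N) (R := ℂ))
    simpa [Matrix.conjTranspose_mul, Matrix.mul_assoc] using h2
  have hR : (H * W * Wᴴ * Hᴴ + 1) * F = H * W := by
    rw [hF, lmmseFilter, ← Matrix.mul_assoc, Matrix.mul_nonsing_inv _
      ((Matrix.isUnit_iff_isUnit_det _).1 hpd.isUnit), Matrix.one_mul]
  have hB : ∃ B, B = H * W := ⟨_, rfl⟩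
  obtain ⟨B, hB⟩ := hB
  have hR1 : B * (Bᴴ * F) + F = B := by
    rw [hB, Matrix.conjTranspose_mul]
    simpa [Matrix.add_mul, Matrix.mul_assoc] using hR
  have hR2 : Fᴴ * (B * Bᴴ) + Fᴴ = Bᴴ := by
    have h := congrArg Matrix.conjTranspose hR1
    simpa [Matrix.conjTranspose_mul, Matrix.mul_assoc] using h
  have hE : ∀ X, mseMatrix H W X = Xᴴ * (B * (Bᴴ * X)) - Xᴴ * B - Bᴴ * X + 1 + Xᴴ * X := by
    intro X
    rw [mseMatrix, Matrix.mul_assoc Xᴴ, ← hB]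
    simp only [Matrix.conjTranspose_sub, Matrix.conjTranspose_mul, Matrix.conjTranspose_one,
      Matrix.conjTranspose_conjTranspose, Matrix.sub_mul, Matrix.mul_sub, Matrix.mul_assoc,
      Matrix.one_mul, Matrix.mul_one]
    abel
  have key : mseMatrix H W (F + D) =
      mseMatrix H W F + (Dᴴ * (B * (Bᴴ * D)) + Dᴴ * D) := by
    have e1 : Dᴴ * (B * (Bᴴ * F)) + Dᴴ * F - Dᴴ * B = 0 := by
      rw [← Matrix.mul_add, hR1, sub_self]
    have e2 : Fᴴ * (B * (Bᴴ * D)) + Fᴴ * D - Bᴴ * D = 0 := by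
      have h := congrArg (· * D) hR2
      simp only [Matrix.add_mul, Matrix.mul_assoc] at h
      rw [h, sub_self]
    rw [hE, hE, ← sub_eq_zero]
    simp only [Matrix.conjTranspose_add, Matrix.add_mul, Matrix.mul_add]
    have e3 := congrArg₂ (· + ·) e1 e2
    simp only [add_zero] at e3
    rw [← e3]
    abel
  have t1 := ((hS.mul_mul_conjTranspose_same D).conjTranspose_mul_mul_same B).trace_nonneg
  have t2 := (hS.mul_mul_conjTranspose_same D).trace_nonneg
  have c1 : (S * (Dᴴ * (B * (Bᴴ * D)))).trace = (Bᴴ * (D * S * Dᴴ) * B).trace := by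
    rw [show S * (Dᴴ * (B * (Bᴴ * D))) = (S * Dᴴ * B) * (Bᴴ * D) by
      simp only [Matrix.mul_assoc], Matrix.trace_mul_comm]
    simp only [Matrix.mul_assoc]
  have c2 : (S * (Dᴴ * D)).trace = (D * S * Dᴴ).trace := by
    rw [← Matrix.mul_assoc, Matrix.trace_mul_comm, Matrix.mul_assoc]
  rw [key, Matrix.mul_add, Matrix.mul_add, Matrix.trace_add, Matrix.trace_add, c1, c2]
  have r1 := (Complex.le_def.1 t1).1
  have r2 := (Complex.le_def.1 t2).1
  simp only [Complex.add_re, Complex.zero_re] at *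
  linarith
end

section
/- Let A and B be n×n Hermitian positive definite complex matrices with B − A positive semidefinite (i.e., A ⪯ B in the Loewner order), and let X be any n×m complex matrix. Then (det(I_m + X† B⁻¹ X)).re ≤ (det(I_m + X† A⁻¹ X)).re. -/
open Matrix
open scoped ComplexOrder

open scoped MatrixOrder in
lemma aux_sqrt {m : ℕ} (Q : Matrix (Fin m) (Fin m) ℂ) (hQ : Q.PosSemidef) :
    ∃ C : Matrix (Fin m) (Fin m) ℂ, Q = Cᴴ * C :=
  CStarAlgebra.nonneg_iff_eq_star_mul_self.1 hQ.nonneg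

lemma aux_inv {n : ℕ} (A B : Matrix (Fin n) (Fin n) ℂ)
    (hA : A.PosDef) (hB : B.PosDef) (hAB : (B - A).PosSemidef) :
    (A⁻¹ - B⁻¹).PosSemidef := by
  have := hA.isUnit.invertible
  have := hB.isUnit.invertible
  have := hA.inv.isUnit.invertible
  have h2 := Matrix.PosDef.fromBlocks₂₂ B (1 : Matrix (Fin n) (Fin n) ℂ) hA.inv
  have h1 := Matrix.PosDef.fromBlocks₁₁ (1 : Matrix (Fin n) (Fin n) ℂ) A⁻¹ hB
  simp only [Matrix.conjTranspose_one, Matrix.one_mul, Matrix.mul_one,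
    Matrix.inv_inv_of_invertible] at h1 h2
  exact h1.1 (h2.2 hAB)

lemma aux_one {m : ℕ} (S : Matrix (Fin m) (Fin m) ℂ) (hS : S.PosSemidef) :
    1 ≤ (1 + S).det := by
  have h : (1 + S).det = ∏ i, (1 + (hS.1.eigenvalues i : ℂ)) := by
    have hs := hS.1.spectral_theorem
    have h1 : 1 + S = Unitary.conjStarAlgAut ℂ _ hS.1.eigenvectorUnitary
        (diagonal (fun i => 1 + (hS.1.eigenvalues i : ℂ))) := by
      rw [← Matrix.diagonal_add, map_add]
      nth_rw 1 [hs]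
      simp [Function.comp_def]
    rw [h1, Unitary.conjStarAlgAut_apply, det_mul_right_comm]
    simp
  rw [h]
  have h2 : (1 : ℝ) ≤ ∏ i, (1 + hS.1.eigenvalues i) :=
    Finset.prod_induction _ (fun x : ℝ => 1 ≤ x) (fun _ _ => one_le_mul_of_one_le_of_one_le) le_rfl
      fun i _ => by linarith [hS.eigenvalues_nonneg i]
  exact_mod_cast h2

lemma aux_det {m : ℕ} (P Q : Matrix (Fin m) (Fin m) ℂ) (hP : P.PosDef) (hQ : Q.PosSemidef) :
    P.det ≤ (P + Q).det := by
  obtain ⟨C, rfl⟩ := aux_sqrt Q hQ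
  rw [Matrix.det_add_mul _ _ ((Matrix.isUnit_iff_isUnit_det _).1 hP.isUnit)]
  have := aux_one (C * P⁻¹ * Cᴴ) (hP.inv.posSemidef.mul_mul_conjTranspose_same C)
  exact le_mul_of_one_le_right hP.det_pos.le this

/-- Let A and B be n×n Hermitian positive definite complex matrices with B − A positive
semidefinite (A ⪯ B in the Loewner order), and let X be any n×m complex matrix. Then
(det(I_m + X† B⁻¹ X)).re ≤ (det(I_m + X† A⁻¹ X)).re. -/
theorem det_re_antitone_in_loewner {n m : ℕ} (A B : Matrix (Fin n) (Fin n) ℂ)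
    (hA : A.PosDef) (hB : B.PosDef) (hAB : (B - A).PosSemidef)
    (X : Matrix (Fin n) (Fin m) ℂ) :
    ((1 : Matrix (Fin m) (Fin m) ℂ) + Xᴴ * B⁻¹ * X).det.re
      ≤ ((1 : Matrix (Fin m) (Fin m) ℂ) + Xᴴ * A⁻¹ * X).det.re := by
  have h := aux_det (1 + Xᴴ * B⁻¹ * X) (Xᴴ * (A⁻¹ - B⁻¹) * X)
    (Matrix.PosDef.one.add_posSemidef (hB.inv.posSemidef.conjTranspose_mul_mul_same X))
    ((aux_inv A B hA hB hAB).conjTranspose_mul_mul_same X)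
  have e : 1 + Xᴴ * B⁻¹ * X + Xᴴ * (A⁻¹ - B⁻¹) * X = 1 + Xᴴ * A⁻¹ * X := by
    rw [Matrix.mul_sub, Matrix.sub_mul]; abel
  rw [e] at h
  exact (Complex.le_def.1 h).1
end

section
/- For any complex matrices H ∈ ℂ^{N×M} and W ∈ ℂ^{M×d}, let S̄ := I_d + W† H† H W and let Ḡ := (H W W† H† + I_N)⁻¹ H W be the LMMSE filter. Then −Re(Tr(S̄ · E(Ḡ,W))) + log((det S̄).re) + d = log((det(I_N + H W W† H†)).re). -/
open Matrix
open scoped ComplexOrder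

theorem mse_key {N d : ℕ} (A : Matrix (Fin N) (Fin d) ℂ) :
    (1 + Aᴴ * A) * ((((A * Aᴴ + 1)⁻¹ * A)ᴴ * A - 1) * (((A * Aᴴ + 1)⁻¹ * A)ᴴ * A - 1)ᴴ
      + ((A * Aᴴ + 1)⁻¹ * A)ᴴ * ((A * Aᴴ + 1)⁻¹ * A)) = 1 := by
  have hSp : (1 + Aᴴ * A).PosDef :=
    Matrix.PosDef.one.add_posSemidef (posSemidef_conjTranspose_mul_self A)
  have hRp : (A * Aᴴ + 1).PosDef :=
    Matrix.PosDef.posSemidef_add (posSemidef_self_mul_conjTranspose A) Matrix.PosDef.one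
  have hSd : IsUnit (1 + Aᴴ * A).det := (Matrix.isUnit_iff_isUnit_det _).1 hSp.isUnit
  have hRd : IsUnit (A * Aᴴ + 1).det := (Matrix.isUnit_iff_isUnit_det _).1 hRp.isUnit
  have hST : (1 + Aᴴ * A) * (1 + Aᴴ * A)⁻¹ = 1 := Matrix.mul_nonsing_inv _ hSd
  have hTS : (1 + Aᴴ * A)⁻¹ * (1 + Aᴴ * A) = 1 := Matrix.nonsing_inv_mul _ hSd
  have hTH : ((1 + Aᴴ * A)⁻¹)ᴴ = (1 + Aᴴ * A)⁻¹ := hSp.isHermitian.inv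
  have hG : (A * Aᴴ + 1)⁻¹ * A = A * (1 + Aᴴ * A)⁻¹ := by
    have h : A * (1 + Aᴴ * A) = (A * Aᴴ + 1) * A := by
      rw [Matrix.mul_add, Matrix.add_mul, Matrix.mul_one, Matrix.one_mul, Matrix.mul_assoc,
        add_comm]
    calc (A * Aᴴ + 1)⁻¹ * A
        = (A * Aᴴ + 1)⁻¹ * (A * ((1 + Aᴴ * A) * (1 + Aᴴ * A)⁻¹)) := by rw [hST, Matrix.mul_one]
      _ = (A * Aᴴ + 1)⁻¹ * ((A * Aᴴ + 1) * (A * (1 + Aᴴ * A)⁻¹)) := by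
          rw [← Matrix.mul_assoc A, h, Matrix.mul_assoc]
      _ = A * (1 + Aᴴ * A)⁻¹ := Matrix.nonsing_inv_mul_cancel_left _ _ hRd
  rw [hG, conjTranspose_mul, hTH]
  generalize (1 + Aᴴ * A)⁻¹ = T at *
  have h1 : T * Aᴴ * A - 1 = -T := by
    rw [Matrix.mul_add, Matrix.mul_one] at hTS
    rw [Matrix.mul_assoc, ← hTS]
    abel
  have h2 : T * Aᴴ * (A * T) = T * (Aᴴ * A) * T := by simp only [Matrix.mul_assoc]
  rw [h1, conjTranspose_neg, hTH, neg_mul_neg, h2]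
  have h3 : T * T + T * (Aᴴ * A) * T = T * (1 + Aᴴ * A) * T := by
    rw [Matrix.mul_add, Matrix.mul_one, Matrix.add_mul]
  rw [h3, hTS, Matrix.one_mul, hST]

/-- With S̄ := I_d + W† H† H W and Ḡ the LMMSE filter,
−Re(Tr(S̄ · E(Ḡ,W))) + log((det S̄).re) + d = log((det(I_N + H W W† H†)).re). -/
theorem weighted_mse_equals_rate_at_fixed_point {N M d : ℕ}
    (H : Matrix (Fin N) (Fin M) ℂ) (W : Matrix (Fin M) (Fin d) ℂ) :
    -(((1 + Wᴴ * Hᴴ * H * W) * mseMatrix H W (lmmseFilter H W)).trace.re)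
      + Real.log ((1 + Wᴴ * Hᴴ * H * W).det.re) + d
    = Real.log ((1 + H * W * Wᴴ * Hᴴ).det.re) := by
  have e1 : Wᴴ * Hᴴ * H * W = (H * W)ᴴ * (H * W) := by
    rw [conjTranspose_mul]; simp only [Matrix.mul_assoc]
  have e2 : H * W * Wᴴ * Hᴴ = (H * W) * (H * W)ᴴ := by
    rw [conjTranspose_mul]; simp only [Matrix.mul_assoc]
  have key := mse_key (H * W)
  have hE : (1 + (H * W)ᴴ * (H * W)) * mseMatrix H W (lmmseFilter H W) = 1 := by
    unfold mseMatrix lmmseFilter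
    rw [e2, Matrix.mul_assoc _ H W]
    exact key
  rw [e1, e2, hE, Matrix.det_one_add_mul_comm (H * W)]
  simp
end

section
/- Let ι be a finite index set and for each e ∈ ι let M_e be an n×n Hermitian positive semidefinite complex matrix. Then the function x ↦ log((det(I_n + Σ_{e∈ι} x_e · M_e)).re) is concave on the set {x : ι → ℝ | x_e ≥ 0 for all e} (i.e., for x, y in the nonnegative orthant and t ∈ [0,1], the function value at t·x + (1−t)·y is at least t times its value at x plus (1−t) times its value at y). -/
open Matrix
open scoped ComplexOrder

open scoped MatrixOrder in
lemma det_pencil {n : ℕ} (A B : Matrix (Fin n) (Fin n) ℂ) (hA : A.PosDef) (hB : B.PosDef) :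
    ∃ (c : ℝ) (l : Fin n → ℝ), 0 < c ∧ (∀ i, 0 < l i) ∧
      ∀ s u : ℝ, ((s : ℂ) • A + (u : ℂ) • B).det = ((c * ∏ i, (s + u * l i) : ℝ) : ℂ) := by
  obtain ⟨C, hC⟩ := CStarAlgebra.nonneg_iff_eq_star_mul_self.mp hA.posSemidef.nonneg
  have hdA : A.det = star C.det * C.det := by
    rw [hC, det_mul, star_eq_conjTranspose, det_conjTranspose]
  have hpos := hA.det_pos
  have hCd : IsUnit C.det := by
    rw [isUnit_iff_ne_zero]
    intro h
    rw [hdA, h] at hpos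
    simp at hpos
  have hCu : IsUnit C := (isUnit_iff_isUnit_det C).2 hCd
  have hDu : IsUnit C⁻¹ := by
    rw [isUnit_iff_isUnit_det]; exact isUnit_nonsing_inv_det C hCd
  have hH : (star C⁻¹ * B * C⁻¹).PosDef := (Matrix.IsUnit.posDef_star_left_conjugate_iff hDu).2 hB
  set H := star C⁻¹ * B * C⁻¹ with hHdef
  have h1 : C⁻¹ * C = 1 := nonsing_inv_mul C hCd
  have h2 : star C * star C⁻¹ = 1 := by rw [← star_mul, h1, star_one]
  have hBH : B = star C * H * C := by
    calc B = (star C * star C⁻¹) * B * (C⁻¹ * C) := by rw [h1, h2]; simp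
      _ = _ := by rw [hHdef]; simp only [mul_assoc]
  have hcre : A.det = ((A.det.re : ℝ) : ℂ) := by
    have := (Complex.lt_def.1 hpos).2
    apply Complex.ext <;> simp at this ⊢
    exact this.symm
  refine ⟨A.det.re, hH.1.eigenvalues, (Complex.lt_def.1 hpos).1, hH.eigenvalues_pos, fun s u => ?_⟩
  have h3 : (s : ℂ) • A + (u : ℂ) • B = star C * ((s : ℂ) • 1 + (u : ℂ) • H) * C := by
    conv_lhs => rw [hBH, hC]
    simp [mul_add, add_mul]
  have h4 : ((s : ℂ) • 1 + (u : ℂ) • H).det = ∏ i, ((s : ℂ) + u * hH.1.eigenvalues i) := by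
    set U := hH.1.eigenvectorUnitary
    have h5 : (s : ℂ) • 1 + (u : ℂ) • H = Unitary.conjStarAlgAut ℂ _ U
        (diagonal fun i => ((s : ℂ) + u * hH.1.eigenvalues i)) := by
      conv_lhs => rw [hH.1.spectral_theorem]
      rw [← map_one (Unitary.conjStarAlgAut ℂ _ U), ← map_smul, ← map_smul, ← map_add]
      congr 1
      ext i j
      by_cases h : i = j <;> simp [h, one_apply, diagonal_apply]
    rw [h5, Unitary.conjStarAlgAut_apply, det_mul_right_comm]
    simp
  rw [h3, det_mul, det_mul, h4, star_eq_conjTranspose, det_conjTranspose]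
  push_cast
  rw [← hcre, hdA]
  ring

lemma logdet_pencil {n : ℕ} (A B : Matrix (Fin n) (Fin n) ℂ) (hA : A.PosDef) (hB : B.PosDef)
    (t : ℝ) (ht0 : 0 ≤ t) (ht1 : t ≤ 1) :
    t * Real.log A.det.re + (1 - t) * Real.log B.det.re ≤
      Real.log ((t : ℂ) • A + ((1 - t : ℝ) : ℂ) • B).det.re := by
  obtain ⟨c, l, hc, hl, h⟩ := det_pencil A B hA hB
  have hA' := h 1 0
  have hB' := h 0 1
  simp only [Complex.ofReal_one, Complex.ofReal_zero, one_smul, zero_smul, add_zero, zero_add,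
    zero_mul, one_mul, Finset.prod_const_one, mul_one] at hA' hB'
  rw [h, hA', hB']
  simp only [Complex.ofReal_re]
  have hp : ∀ i, 0 < t + (1 - t) * l i := fun i => by
    rcases eq_or_lt_of_le ht0 with h0 | h0
    · subst h0; simpa using hl i
    · have := mul_nonneg (sub_nonneg.2 ht1) (hl i).le
      linarith
  rw [Real.log_mul hc.ne' (Finset.prod_pos fun i _ => hl i).ne',
    Real.log_mul hc.ne' (Finset.prod_pos fun i _ => hp i).ne',
    Real.log_prod (fun i _ => (hl i).ne'), Real.log_prod (fun i _ => (hp i).ne')]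
  have key : (1 - t) * ∑ i, Real.log (l i) ≤ ∑ i, Real.log (t + (1 - t) * l i) := by
    rw [Finset.mul_sum]
    refine Finset.sum_le_sum fun i _ => ?_
    have := strictConcaveOn_log_Ioi.concaveOn.2 (Set.mem_Ioi.2 one_pos) (Set.mem_Ioi.2 (hl i))
      ht0 (sub_nonneg.2 ht1) (by ring)
    simpa using this
  linarith

lemma posDef_one_add {ι : Type*} [Fintype ι] {n : ℕ}
    (M : ι → Matrix (Fin n) (Fin n) ℂ) (hM : ∀ e, (M e).PosSemidef)
    (x : ι → ℝ) (hx : ∀ e, 0 ≤ x e) :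
    ((1 : Matrix (Fin n) (Fin n) ℂ) + ∑ e, ((x e : ℝ) : ℂ) • M e).PosDef :=
  PosDef.one.add_posSemidef (posSemidef_sum _ fun e _ =>
    (hM e).smul (by exact_mod_cast hx e))

/-- For a finite family of Hermitian positive semidefinite matrices M_e, the function
x ↦ log((det(I_n + Σ_e x_e·M_e)).re) is concave on the nonnegative orthant. -/
theorem logdet_concave_on_nonneg_orthant {ι : Type*} [Fintype ι] {n : ℕ}
    (M : ι → Matrix (Fin n) (Fin n) ℂ) (hM : ∀ e, (M e).PosSemidef)
    (x y : ι → ℝ) (hx : ∀ e, 0 ≤ x e) (hy : ∀ e, 0 ≤ y e)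
    (t : ℝ) (ht0 : 0 ≤ t) (ht1 : t ≤ 1) :
    Real.log (((1 : Matrix (Fin n) (Fin n) ℂ)
        + ∑ e, ((t * x e + (1 - t) * y e : ℝ) : ℂ) • M e).det.re)
      ≥ t * Real.log (((1 : Matrix (Fin n) (Fin n) ℂ) + ∑ e, ((x e : ℝ) : ℂ) • M e).det.re)
        + (1 - t) * Real.log (((1 : Matrix (Fin n) (Fin n) ℂ)
            + ∑ e, ((y e : ℝ) : ℂ) • M e).det.re) := by
  have h := logdet_pencil _ _ (posDef_one_add M hM x hx) (posDef_one_add M hM y hy) t ht0 ht1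
  have e : (1 : Matrix (Fin n) (Fin n) ℂ) + ∑ e, ((t * x e + (1 - t) * y e : ℝ) : ℂ) • M e
      = (t : ℂ) • (1 + ∑ e, ((x e : ℝ) : ℂ) • M e)
        + ((1 - t : ℝ) : ℂ) • (1 + ∑ e, ((y e : ℝ) : ℂ) • M e) := by
    have h1 : (1 : Matrix (Fin n) (Fin n) ℂ) = (t : ℂ) • 1 + ((1 - t : ℝ) : ℂ) • 1 := by
      rw [← add_smul]; simp
    conv_lhs => rw [h1]
    simp only [smul_add, Finset.smul_sum, smul_smul, Complex.ofReal_add, Complex.ofReal_mul,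
      add_smul, Finset.sum_add_distrib]
    abel
  rw [e]
  exact h
end
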